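/- arXiv:2004.15025 — 3 statements merged into one kernel-verified Lean document; each statement's English description precedes it below -/
import Mathlib

section
/- Let f and b be real-valued functions on the finite subsets of ℤ^d, both Θ-invariant (f(θΛ) = f(Λ) and b(θΛ) = b(Λ) for all θ ∈ Θ), with b amenable, and suppose f(Λ₁ ∪ Λ₂) ≤ f(Λ₁) + f(Λ₂) + min(b(Λ₁), b(Λ₂)) for all disjoint finite Λ₁, Λ₂ ⊆ ℤ^d. Then n^{−d} f(Π_n) converges to a limit in [−∞, ∞) as n → ∞, this limit equals inf{ n^{−d}(f(Π_n) + b(Π_n)): n a positive multiple of N }, and for every Van Hove sequence (Λ_n), limsup_{n→∞} |Λ_n|^{−1} f(Λ_n) ≤ lim_{n→∞} n^{−d} f(Π_n). If the inequality f(Λ₁ ∪ Λ₂) ≤ f(Λ₁) + f(Λ₂) + min(b(Λ₁), b(Λ₂)) is only assumed when some vertex of Λ₁ is adjacent to some vertex of Λ₂ in the nearest-neighbor lattice, then all conclusions remain valid, except that for the last assertion each Λ_n is additionally required to be connected. -/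
open Filter Set

noncomputable section

/-- The lattice `ℤ^d`. -/
abbrev V (d : ℕ) := Fin d → ℤ

/-- Nearest-neighbour graph distance `d₁` on `ℤ^d`. -/
def dist1 {d : ℕ} (x y : V d) : ℕ := ∑ i, (x i - y i).natAbs

/-- Nearest-neighbour adjacency on `ℤ^d`. -/
def adj1 {d : ℕ} (x y : V d) : Prop := dist1 x y = 1

/-- The connected component of `x` inside a set `s`. -/
def compIn {d : ℕ} (s : Set (V d)) (x : V d) : Set (V d) :=
  {y | Relation.ReflTransGen (fun a b => a ∈ s ∧ b ∈ s ∧ adj1 a b) x y}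

/-- The set `s` is connected. -/
def ConnSet {d : ℕ} (s : Set (V d)) : Prop := ∀ x ∈ s, ∀ y ∈ s, y ∈ compIn s x

/-- The box `Π_n = ([0,n) ∩ ℤ)^d`. -/
def boxF (d n : ℕ) : Finset (V d) := Fintype.piFinset fun _ => Finset.Ico (0 : ℤ) (n : ℤ)

/-- The outer vertex boundary `∂Λ`. -/
def outerBd {d : ℕ} (Λ : Finset (V d)) : Set (V d) :=
  {x | x ∉ Λ ∧ ∃ y ∈ Λ, dist1 x y = 1}

/-- Van Hove sequences. -/
def VanHove {d : ℕ} (Λs : ℕ → Finset (V d)) : Prop :=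
  Tendsto (fun n => ((Λs n).card : ℝ)) atTop atTop ∧
  Tendsto (fun n => ((outerBd (Λs n)).ncard : ℝ) / ((Λs n).card : ℝ)) atTop (nhds 0)

/-- An amenable function on the finite subsets of `ℤ^d`. -/
def Amenable {d : ℕ} (L : AddSubgroup (V d)) (b : Finset (V d) → ℝ) : Prop :=
  (∀ Λ, 0 ≤ b Λ) ∧
  (∀ z ∈ L, ∀ Λ : Finset (V d), b (Λ.image (· + z)) = b Λ) ∧
  (∀ Λ Δ : Finset (V d), Disjoint Λ Δ → b (Λ ∪ Δ) ≤ b Λ + b Δ) ∧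
  (∀ Λs : ℕ → Finset (V d), VanHove Λs →
    Tendsto (fun n => b (Λs n) / ((Λs n).card : ℝ)) atTop (nhds 0))

/-- The conclusion of Statement 14, with an extra requirement `extra` on the
Van Hove sequences appearing in the last assertion. -/
def SubaddConcl {d : ℕ} (N : ℕ) (f b : Finset (V d) → ℝ)
    (extra : (ℕ → Finset (V d)) → Prop) : Prop :=
  ∃ l : EReal, l ≠ ⊤ ∧
    Tendsto (fun n : ℕ => ((f (boxF d n) / (n : ℝ) ^ d : ℝ) : EReal)) atTop (nhds l) ∧
    l = ⨅ k : {n : ℕ // 0 < n ∧ N ∣ n},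
      (((f (boxF d (k : ℕ)) + b (boxF d (k : ℕ))) / ((k : ℕ) : ℝ) ^ d : ℝ) : EReal) ∧
    ∀ Λs : ℕ → Finset (V d), VanHove Λs → extra Λs →
      limsup (fun n => ((f (Λs n) / ((Λs n).card : ℝ) : ℝ) : EReal)) atTop ≤ l

lemma exists_exit_edge {α : Type*} {r : α → α → Prop} {x y : α}
    (h : Relation.ReflTransGen r x y) (T : Set α) (hx : x ∈ T) (hy : y ∉ T) :
    ∃ a b, a ∈ T ∧ b ∉ T ∧ r a b := by
  induction h with
  | refl => exact absurd hx hy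
  | @tail b c _ hbc ih =>
    by_cases hb : b ∈ T
    · exact ⟨b, c, hb, hy, hbc⟩
    · exact ih hb

lemma dist1_comm {d : ℕ} (x y : V d) : dist1 x y = dist1 y x := by
  unfold dist1
  exact Finset.sum_congr rfl fun i _ => by omega

/-- Moving one coordinate of `x` by one step towards `y`. -/
lemma exists_adj_step {d : ℕ} {x y : V d} (h : x ≠ y) :
    ∃ x' : V d, adj1 x x' ∧ dist1 x' y < dist1 x y ∧
      ∀ i, min (x i) (y i) ≤ x' i ∧ x' i ≤ max (x i) (y i) := by
  classical
  obtain ⟨i, hi⟩ := Function.ne_iff.1 h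
  obtain ⟨e, he1, he2, he3⟩ : ∃ e : ℤ, (x i - e).natAbs = 1 ∧
      (e - y i).natAbs < (x i - y i).natAbs ∧ min (x i) (y i) ≤ e ∧ e ≤ max (x i) (y i) := by
    rcases lt_or_gt_of_ne hi with h' | h'
    · exact ⟨x i + 1, by omega, by omega, by omega⟩
    · exact ⟨x i - 1, by omega, by omega, by omega⟩
  refine ⟨Function.update x i e, ?_, ?_, fun j => ?_⟩
  · unfold adj1 dist1
    rw [Finset.sum_eq_single i]
    · simpa using he1
    · intro j _ hj
      simp [hj]
    · simp
  · unfold dist1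
    refine Finset.sum_lt_sum (fun j _ => ?_) ⟨i, Finset.mem_univ _, by simpa using he2⟩
    by_cases hj : j = i
    · subst hj
      simpa using he2.le
    · simp [hj]
  · by_cases hj : j = i
    · subst hj
      simpa using he3
    · simp [hj]

lemma connSet_Ico_box {d : ℕ} (a c : V d) : ConnSet {x : V d | ∀ i, a i ≤ x i ∧ x i < c i} := by
  intro x hx y hy
  obtain ⟨k, hk⟩ : ∃ k, dist1 x y = k := ⟨_, rfl⟩
  induction k using Nat.strong_induction_on generalizing x with
  | _ k ih =>
    by_cases hxy : x = y
    · subst hxy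
      exact Relation.ReflTransGen.refl
    · obtain ⟨x', h1, h2, h3⟩ := exists_adj_step hxy
      have hx' : x' ∈ {x : V d | ∀ i, a i ≤ x i ∧ x i < c i} := by
        intro i
        have := hx i
        have := hy i
        have := h3 i
        omega
      exact Relation.ReflTransGen.head ⟨hx, hx', h1⟩ (ih _ (hk ▸ h2) x' hx' rfl)

lemma mem_boxF {d n : ℕ} {x : V d} : x ∈ boxF d n ↔ ∀ i, 0 ≤ x i ∧ x i < n := by
  simp [boxF]

lemma card_boxF (d n : ℕ) : (boxF d n).card = n ^ d := by
  simp [boxF]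

lemma connSet_boxF (d n : ℕ) : ConnSet (↑(boxF d n) : Set (V d)) := by
  have : (↑(boxF d n) : Set (V d)) = {x | ∀ i, (0 : V d) i ≤ x i ∧ x i < (fun _ => (n : ℤ)) i} := by
    ext x
    simp [mem_boxF]
  rw [this]
  exact connSet_Ico_box _ _

/-- The cell containing `x` in the tiling of `ℤ^d` by translates of `Π_n`. -/
def cell {d : ℕ} (n : ℕ) (x : V d) : Finset (V d) :=
  (boxF d n).image (· + (n : ℤ) • fun i => x i / n)

lemma mem_cell_iff {d n : ℕ} {x y : V d} :
    y ∈ cell n x ↔ ∀ i, n * (x i / n) ≤ y i ∧ y i < n * (x i / n) + n := by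
  simp only [cell, Finset.mem_image, mem_boxF]
  constructor
  · rintro ⟨z, hz, rfl⟩ i
    have := hz i
    simp only [Pi.add_apply, Pi.smul_apply, smul_eq_mul]
    omega
  · intro h
    refine ⟨y - (n : ℤ) • fun i => x i / n, fun i => ?_, by simp⟩
    have := h i
    simp only [Pi.sub_apply, Pi.smul_apply, smul_eq_mul]
    omega

lemma mem_cell_self {d n : ℕ} (hn : 0 < n) (x : V d) : x ∈ cell n x := by
  rw [mem_cell_iff]
  intro i
  have hn' : (0 : ℤ) < n := by exact_mod_cast hn
  have h1 := Int.mul_ediv_add_emod (x i) n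
  have h2 := Int.emod_nonneg (x i) hn'.ne'
  have h3 := Int.emod_lt_of_pos (x i) hn'
  omega

lemma cell_eq_of_mem {d n : ℕ} {x y : V d} (h : y ∈ cell n x) : cell n y = cell n x := by
  have key : ∀ i, y i / n = x i / n := by
    intro i
    obtain ⟨h1, h2⟩ := mem_cell_iff.1 h i
    have hn' : (0 : ℤ) < n := by omega
    apply le_antisymm
    · rw [← Int.lt_add_one_iff, Int.ediv_lt_iff_lt_mul hn']
      linarith
    · rw [Int.le_ediv_iff_mul_le hn']
      linarith
  simp only [cell, key]

lemma card_cell {d : ℕ} (n : ℕ) (x : V d) : (cell n x).card = n ^ d := by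
  rw [cell, Finset.card_image_of_injective _ (add_left_injective _), card_boxF]

lemma connSet_cell {d : ℕ} (n : ℕ) (x : V d) : ConnSet (↑(cell n x) : Set (V d)) := by
  have : (↑(cell n x) : Set (V d)) = {y | ∀ i, (fun i => (n : ℤ) * (x i / n)) i ≤ y i ∧
      y i < (fun i => n * (x i / n) + (n : ℤ)) i} := by
    ext y
    exact mem_cell_iff
  rw [this]
  exact connSet_Ico_box _ _

lemma outerBd_finite {d : ℕ} (Λ : Finset (V d)) : (outerBd Λ).Finite := by
  have hsub : outerBd Λ ⊆ ⋃ y ∈ Λ, Set.Icc (y - 1) (y + 1) := by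
    rintro x ⟨_, y, hy, hxy⟩
    simp only [Set.mem_iUnion]
    have hle : ∀ i, (x i - y i).natAbs ≤ 1 := fun i => hxy ▸
      Finset.single_le_sum (f := fun i => (x i - y i).natAbs) (fun _ _ => Nat.zero_le _)
        (Finset.mem_univ i)
    refine ⟨y, hy, fun i => ?_, fun i => ?_⟩
    · have := hle i
      simp only [Pi.sub_apply, Pi.one_apply]
      omega
    · have := hle i
      simp only [Pi.add_apply, Pi.one_apply]
      omega
  exact (Λ.finite_toSet.biUnion fun y _ => Set.finite_Icc _ _).subset hsub

lemma ncard_outerBd_boxF_le (d n : ℕ) :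
    (outerBd (boxF d n)).ncard + n ^ d ≤ (n + 2) ^ d := by
  classical
  have h1 : (outerBd (boxF d n)).ncard + n ^ d
      = ((outerBd_finite (boxF d n)).toFinset ∪ boxF d n).card := by
    rw [Finset.card_union_of_disjoint, card_boxF, Set.ncard_eq_toFinset_card _ (outerBd_finite _)]
    rw [Finset.disjoint_left]
    intro x hx
    exact ((Set.Finite.mem_toFinset _).1 hx).1
  have h2 : (Fintype.piFinset fun _ : Fin d => Finset.Ico (-1 : ℤ) (n + 1)).card = (n + 2) ^ d := by
    rw [Fintype.card_piFinset]
    simp only [Int.card_Ico, Finset.prod_const, Finset.card_univ, Fintype.card_fin]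
    congr 1
  rw [h1, ← h2]
  refine Finset.card_le_card fun x hx => ?_
  rw [Fintype.mem_piFinset]
  intro i
  rw [Finset.mem_Ico]
  rcases Finset.mem_union.1 hx with hx | hx
  · obtain ⟨_, y, hy, hxy⟩ := (Set.Finite.mem_toFinset _).1 hx
    have hle : (x i - y i).natAbs ≤ 1 := hxy ▸
      Finset.single_le_sum (f := fun i => (x i - y i).natAbs) (fun _ _ => Nat.zero_le _)
        (Finset.mem_univ i)
    have := mem_boxF.1 hy i
    omega
  · have := mem_boxF.1 hx i
    omega

lemma tendsto_add_div_pow_one (c d : ℕ) :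
    Tendsto (fun n : ℕ => (((n : ℝ) + c) / n) ^ d) atTop (nhds 1) := by
  have h1 : Tendsto (fun n : ℕ => 1 + (c : ℝ) / n) atTop (nhds (1 + 0)) :=
    (tendsto_const_div_atTop_nhds_zero_nat (c : ℝ)).const_add 1
  have h2 := h1.pow d
  rw [add_zero, one_pow] at h2
  refine h2.congr' ?_
  filter_upwards [eventually_gt_atTop 0] with n hn
  have : (n : ℝ) ≠ 0 := by positivity
  rw [add_div, div_self this]

lemma vanHove_boxF {d : ℕ} (hd : 1 ≤ d) : VanHove (boxF d) := by
  constructor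
  · simp only [card_boxF, Nat.cast_pow]
    exact (tendsto_pow_atTop (by omega)).comp tendsto_natCast_atTop_atTop
  · have h := (tendsto_add_div_pow_one 2 d).sub_const 1
    rw [sub_self] at h
    refine squeeze_zero' (Eventually.of_forall fun n => by positivity) ?_ h
    filter_upwards [eventually_gt_atTop 0] with n hn
    have h1 : ((outerBd (boxF d n)).ncard : ℝ) + (n : ℝ) ^ d ≤ ((n : ℝ) + 2) ^ d := by
      exact_mod_cast ncard_outerBd_boxF_le d n
    have h2 : (0 : ℝ) < (n : ℝ) ^ d := by positivity
    rw [card_boxF, div_pow, Nat.cast_pow, div_le_iff₀ h2, sub_mul, div_mul_cancel₀ _ h2.ne']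
    push_cast
    linarith

open Classical in
/-- Points whose cell is not contained in `Λ` are controlled by the boundary of `Λ`. -/
lemma card_filter_not_cell_subset_le {d n : ℕ} (hn : 0 < n) (Λ : Finset (V d)) :
    (Λ.filter fun x => ¬ cell n x ⊆ Λ).card ≤ (outerBd Λ).ncard * n ^ d := by
  rw [Set.ncard_eq_toFinset_card _ (outerBd_finite _)]
  refine le_trans (Finset.card_le_card (t := (outerBd_finite Λ).toFinset.biUnion (cell n)) ?_)
    (Finset.card_biUnion_le_card_mul _ _ _ fun z _ => (card_cell n z).le)
  intro x hx
  obtain ⟨hxΛ, hx⟩ := Finset.mem_filter.1 hx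
  obtain ⟨y, hy, hyΛ⟩ := Finset.not_subset.1 hx
  obtain ⟨a, b, ha, hb, _, hbc, hab⟩ := exists_exit_edge
    (connSet_cell n x x (mem_cell_self hn x) y hy) (↑Λ : Set (V d)) hxΛ hyΛ
  refine Finset.mem_biUnion.2 ⟨b, (Set.Finite.mem_toFinset _).2 ⟨hb, a, ha, ?_⟩, ?_⟩
  · rw [dist1_comm]
    exact hab
  · rw [cell_eq_of_mem hbc]
    exact mem_cell_self hn x

/-- Connectedness of `s` with respect to an arbitrary relation `A`. -/
def RelConn {d : ℕ} (A : V d → V d → Prop) (s : Set (V d)) : Prop :=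
  ∀ x ∈ s, ∀ y ∈ s, Relation.ReflTransGen (fun a b => a ∈ s ∧ b ∈ s ∧ A a b) x y

lemma ConnSet.relConn {d : ℕ} {A : V d → V d → Prop} (hA : ∀ x y, adj1 x y → A x y)
    {s : Set (V d)} (hs : ConnSet s) : RelConn A s := fun x hx y hy =>
  Relation.ReflTransGen.mono (fun _ _ h => ⟨h.1, h.2.1, hA _ _ h.2.2⟩) x y (hs x hx y hy)

/-- Almost subadditivity for pairs of disjoint sets joined by an `A`-edge. -/
def RelSubadd {d : ℕ} (A : V d → V d → Prop) (f b : Finset (V d) → ℝ) : Prop :=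
  ∀ Λ Δ : Finset (V d), Disjoint Λ Δ → (∃ x ∈ Λ, ∃ y ∈ Δ, A x y) →
    f (Λ ∪ Δ) ≤ f Λ + f Δ + min (b Λ) (b Δ)

open Classical in
/-- Adding the classes `p y` of a partition one at a time to `T` until `Λ` is exhausted. -/
lemma RelSubadd.le_add_sum {d : ℕ} {A : V d → V d → Prop} {f b : Finset (V d) → ℝ}
    (hf : RelSubadd A f b) {Λ : Finset (V d)} (hΛ : RelConn A (↑Λ : Set (V d)))
    (p : V d → Finset (V d)) (T : Finset (V d)) (hT : T ⊆ Λ) (hTne : T.Nonempty)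
    (hself : ∀ y ∈ Λ \ T, y ∈ p y) (hsub : ∀ y ∈ Λ \ T, p y ⊆ Λ \ T)
    (hcls : ∀ y ∈ Λ \ T, ∀ z ∈ p y, p z = p y) :
    f Λ ≤ f T + ∑ x ∈ Λ \ T, (f (p x) + b (p x)) / ((p x).card : ℝ) := by
  obtain ⟨k, hk⟩ : ∃ k, (Λ \ T).card = k := ⟨_, rfl⟩
  induction k using Nat.strong_induction_on generalizing T with
  | _ k ih =>
    by_cases hTΛ : Λ ⊆ T
    · obtain rfl := hT.antisymm hTΛ
      simp
    · obtain ⟨z, hz, hzT⟩ := Finset.not_subset.1 hTΛ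
      obtain ⟨x, hx⟩ := hTne
      obtain ⟨a, y, ha, hy, _, hyΛ, hay⟩ := exists_exit_edge (hΛ x (hT hx) z hz)
        (↑T : Set (V d)) hx hzT
      have hy' : y ∈ Λ \ T := Finset.mem_sdiff.2 ⟨hyΛ, hy⟩
      have hps := hsub y hy'
      have hdisj : Disjoint T (p y) :=
        Finset.disjoint_left.2 fun v hv hv' => (Finset.mem_sdiff.1 (hps hv')).2 hv
      have hset : Λ \ (T ∪ p y) = (Λ \ T) \ p y := sdiff_sdiff_left.symm
      have hss : Λ \ (T ∪ p y) ⊆ Λ \ T := hset ▸ Finset.sdiff_subset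
      have hstep := ih (Λ \ (T ∪ p y)).card
        (hk ▸ Finset.card_lt_card (Finset.ssubset_iff_subset_ne.2 ⟨hss, fun h => by
          rw [← h, hset] at hy'
          exact (Finset.mem_sdiff.1 hy').2 (hself y (h ▸ hset ▸ hy'))⟩))
        (T ∪ p y) (Finset.union_subset hT fun v hv => (Finset.mem_sdiff.1 (hps hv)).1)
        ⟨x, Finset.mem_union_left _ hx⟩ (fun v hv => hself v (hss hv))
        (fun v hv w hw => by
          rw [hset, Finset.mem_sdiff]
          refine ⟨hsub v (hss hv) hw, fun hwy => ?_⟩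
          have h1 := hcls v (hss hv) w hw
          have h2 := hcls y hy' w hwy
          have h3 := hself v (hss hv)
          rw [← h1, h2] at h3
          exact (Finset.mem_sdiff.1 (hset ▸ hv)).2 h3)
        (fun v hv => hcls v (hss hv)) rfl
      have hsum : ∑ x ∈ p y, (f (p x) + b (p x)) / ((p x).card : ℝ) = f (p y) + b (p y) := by
        have hc : ((p y).card : ℝ) ≠ 0 := by
          exact_mod_cast Finset.card_ne_zero_of_mem (hself y hy')
        rw [Finset.sum_congr rfl fun v hv => by rw [hcls y hy' v hv], Finset.sum_const,
          nsmul_eq_mul, mul_div_cancel₀ _ hc]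
      have hmerge := hf T (p y) hdisj ⟨a, ha, y, hself y hy', hay⟩
      have hmin := min_le_right (b T) (b (p y))
      rw [← Finset.sum_sdiff hps, hsum, ← hset]
      linarith

/-- The values of an invariant function at single points are bounded. -/
lemma exists_singleton_bound {d : ℕ} {L : AddSubgroup (V d)} {N : ℕ} (hN : 0 < N)
    (hL : ∀ x : V d, (N : ℤ) • x ∈ L) {g : Finset (V d) → ℝ}
    (hg : ∀ z ∈ L, ∀ Λ : Finset (V d), g (Λ.image (· + z)) = g Λ) :
    ∃ C : ℝ, 0 ≤ C ∧ ∀ x, g {x} ≤ C := by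
  refine ⟨∑ v ∈ boxF d N, |g {v}|, Finset.sum_nonneg fun _ _ => abs_nonneg _, fun x => ?_⟩
  obtain ⟨v, hv, hvx⟩ := Finset.mem_image.1 (mem_cell_self hN x)
  have h := hg _ (hL fun i => x i / N) {v}
  rw [Finset.image_singleton, hvx] at h
  rw [h]
  exact (le_abs_self _).trans
    (Finset.single_le_sum (f := fun v => |g {v}|) (fun _ _ => abs_nonneg _) hv)

lemma apply_cell {d : ℕ} {L : AddSubgroup (V d)} {N n : ℕ} (hn : N ∣ n)
    (hL : ∀ x : V d, (N : ℤ) • x ∈ L) {g : Finset (V d) → ℝ}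
    (hg : ∀ z ∈ L, ∀ Λ : Finset (V d), g (Λ.image (· + z)) = g Λ) (x : V d) :
    g (cell n x) = g (boxF d n) := by
  obtain ⟨m, rfl⟩ := hn
  refine hg _ ?_ _
  rw [Nat.cast_mul, mul_smul]
  exact hL _

open Classical in
/-- Tiling `Λ` by translates of `Π_n` and single points. -/
lemma RelSubadd.le_of_tiling {d : ℕ} {L : AddSubgroup (V d)} {N n : ℕ} (hNn : N ∣ n) (hn : 0 < n)
    (hL : ∀ x : V d, (N : ℤ) • x ∈ L) {A : V d → V d → Prop} {f b : Finset (V d) → ℝ}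
    (hf : RelSubadd A f b)
    (hfinv : ∀ z ∈ L, ∀ Λ : Finset (V d), f (Λ.image (· + z)) = f Λ)
    (hbinv : ∀ z ∈ L, ∀ Λ : Finset (V d), b (Λ.image (· + z)) = b Λ)
    (hb0 : ∀ Λ, 0 ≤ b Λ) {C : ℝ} (hC0 : 0 ≤ C) (hC : ∀ x, f {x} + b {x} ≤ C)
    {Λ : Finset (V d)} (hne : Λ.Nonempty) (hΛ : RelConn A (↑Λ : Set (V d))) :
    f Λ ≤ (f (boxF d n) + b (boxF d n)) / (n : ℝ) ^ d * Λ.card +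
      (C + |(f (boxF d n) + b (boxF d n)) / (n : ℝ) ^ d|) *
        ((outerBd Λ).ncard * (n : ℝ) ^ d) := by
  set α := (f (boxF d n) + b (boxF d n)) / (n : ℝ) ^ d with hα
  set p : V d → Finset (V d) := fun x => if cell n x ⊆ Λ then cell n x else {x} with hp
  have hself : ∀ y, y ∈ p y := by
    intro y
    simp only [hp]
    split_ifs
    · exact mem_cell_self hn y
    · simp
  have hsub : ∀ y ∈ Λ, p y ⊆ Λ := by
    intro y hy
    simp only [hp]
    split_ifs with h
    · exact h
    · simpa using hy
  have hcls : ∀ y, ∀ z ∈ p y, p z = p y := by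
    intro y z hz
    by_cases h : cell n y ⊆ Λ
    · have h' : p y = cell n y := if_pos h
      have h2 := cell_eq_of_mem (h' ▸ hz)
      simp only [hp, h2, if_pos h]
    · have h' : p y = {y} := if_neg h
      rw [h', Finset.mem_singleton] at hz
      rw [hz]
  set w : V d → ℝ := fun x => (f (p x) + b (p x)) / ((p x).card : ℝ) with hw
  obtain ⟨x₀, hx₀⟩ := hne
  have h1 := hf.le_add_sum hΛ p (p x₀) (hsub x₀ hx₀) ⟨x₀, hself x₀⟩ (fun y _ => hself y)
    (fun y hy v hv => by
      rw [Finset.mem_sdiff] at hy ⊢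
      refine ⟨hsub y hy.1 hv, fun hv' => hy.2 ?_⟩
      rw [← hcls x₀ v hv', hcls y v hv]
      exact hself y) (fun y _ => hcls y)
  have h2 : f (p x₀) ≤ ∑ x ∈ p x₀, w x := by
    have hc : ((p x₀).card : ℝ) ≠ 0 := by
      exact_mod_cast Finset.card_ne_zero_of_mem (hself x₀)
    rw [Finset.sum_congr rfl fun v hv => by simp only [hw]; rw [hcls x₀ v hv], Finset.sum_const,
      nsmul_eq_mul, mul_div_cancel₀ _ hc]
    linarith [hb0 (p x₀)]
  have h3 : f Λ ≤ ∑ x ∈ Λ, w x := by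
    rw [← Finset.sum_sdiff (hsub x₀ hx₀)]
    linarith
  have h4 : ∀ x, w x ≤ α + if ¬ cell n x ⊆ Λ then C + |α| else 0 := by
    intro x
    by_cases h : cell n x ⊆ Λ
    · have h' : p x = cell n x := if_pos h
      simp only [hw, h', apply_cell hNn hL hfinv, apply_cell hNn hL hbinv, card_cell, h,
        not_true_eq_false, if_false, add_zero, Nat.cast_pow, hα, le_refl]
    · have h' : p x = {x} := if_neg h
      simp only [hw, h', h, not_false_eq_true, if_true, Finset.card_singleton, Nat.cast_one,
        div_one]
      linarith [hC x, neg_abs_le α]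
  have h5 : ∑ x ∈ Λ, w x ≤ α * Λ.card +
      (C + |α|) * ((Λ.filter fun x => ¬ cell n x ⊆ Λ).card : ℝ) := by
    refine (Finset.sum_le_sum fun x _ => h4 x).trans (le_of_eq ?_)
    rw [Finset.sum_add_distrib, ← Finset.sum_filter, Finset.sum_const, Finset.sum_const,
      nsmul_eq_mul, nsmul_eq_mul]
    ring
  have h6 : ((Λ.filter fun x => ¬ cell n x ⊆ Λ).card : ℝ) ≤
      (outerBd Λ).ncard * (n : ℝ) ^ d := by
    exact_mod_cast card_filter_not_cell_subset_le hn Λ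
  have h7 := mul_le_mul_of_nonneg_left h6 (add_nonneg hC0 (abs_nonneg α))
  linarith

/-- Filling up `Π_k` to a larger box by single points. -/
lemma RelSubadd.boxF_le {d : ℕ} {A : V d → V d → Prop} {f b : Finset (V d) → ℝ}
    (hf : RelSubadd A f b) (hA : ∀ x y, adj1 x y → A x y) {C : ℝ}
    (hC : ∀ x, f {x} + b {x} ≤ C) {k m : ℕ} (hk : 0 < k) (hkm : k ≤ m) :
    f (boxF d m) ≤ f (boxF d k) + C * ((m : ℝ) ^ d - (k : ℝ) ^ d) := by
  classical
  have hsub : boxF d k ⊆ boxF d m := fun x hx => mem_boxF.2 fun i => by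
    have := mem_boxF.1 hx i
    omega
  have h := hf.le_add_sum ((connSet_boxF d m).relConn hA) (fun x => {x}) (boxF d k) hsub
    ⟨0, mem_boxF.2 fun i => by simpa using hk⟩ (by simp) (by simp) (by simp)
  refine h.trans (add_le_add_right ?_ _)
  refine (Finset.sum_le_card_nsmul _ _ C fun x _ => by simpa using hC x).trans (le_of_eq ?_)
  rw [nsmul_eq_mul, Finset.card_sdiff_of_subset hsub, Nat.cast_sub (Finset.card_le_card hsub),
    card_boxF, card_boxF, Nat.cast_pow, Nat.cast_pow, mul_comm]

/-- Upper bound along Van Hove sequences. -/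
lemma RelSubadd.limsup_le {d : ℕ} {L : AddSubgroup (V d)} {N n : ℕ} (hNn : N ∣ n) (hn : 0 < n)
    (hN : 0 < N) (hL : ∀ x : V d, (N : ℤ) • x ∈ L) {A : V d → V d → Prop}
    {f b : Finset (V d) → ℝ} (hf : RelSubadd A f b)
    (hfinv : ∀ z ∈ L, ∀ Λ : Finset (V d), f (Λ.image (· + z)) = f Λ) (hb : Amenable L b)
    {Λs : ℕ → Finset (V d)} (hΛ : VanHove Λs) (hconn : ∀ k, RelConn A (↑(Λs k) : Set (V d))) :
    limsup (fun k => ((f (Λs k) / ((Λs k).card : ℝ) : ℝ) : EReal)) atTop ≤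
      (((f (boxF d n) + b (boxF d n)) / (n : ℝ) ^ d : ℝ) : EReal) := by
  obtain ⟨hb0, hbinv, -, -⟩ := hb
  obtain ⟨C, hC0, hC⟩ := exists_singleton_bound hN hL (g := fun Λ => f Λ + b Λ)
    fun z hz Λ => by rw [hfinv z hz, hbinv z hz]
  set α := (f (boxF d n) + b (boxF d n)) / (n : ℝ) ^ d with hα
  have hlim : Tendsto (fun k => α + (C + |α|) * (n : ℝ) ^ d *
      (((outerBd (Λs k)).ncard : ℝ) / ((Λs k).card : ℝ))) atTop (nhds α) := by
    simpa using (hΛ.2.const_mul ((C + |α|) * (n : ℝ) ^ d)).const_add α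
  refine le_trans (limsup_le_limsup ?_) (EReal.tendsto_coe.2 hlim).limsup_eq.le
  filter_upwards [hΛ.1.eventually_gt_atTop 0] with k hk
  have hne : (Λs k).Nonempty := Finset.card_pos.1 (by exact_mod_cast hk)
  have h := hf.le_of_tiling hNn hn hL hfinv hbinv hb0 hC0 hC hne (hconn k)
  rw [← hα] at h
  rw [EReal.coe_le_coe_iff, div_le_iff₀ hk, add_mul, mul_assoc _ (_ / _), div_mul_cancel₀ _ hk.ne']
  linarith

lemma RelSubadd.subaddConcl {d : ℕ} (hd : 1 ≤ d) {L : AddSubgroup (V d)} {N : ℕ}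
    (hN : 0 < N) (hL : ∀ x : V d, (N : ℤ) • x ∈ L) {A : V d → V d → Prop}
    (hA : ∀ x y, adj1 x y → A x y) {f b : Finset (V d) → ℝ} (hf : RelSubadd A f b)
    (hfinv : ∀ z ∈ L, ∀ Λ : Finset (V d), f (Λ.image (· + z)) = f Λ) (hb : Amenable L b) :
    SubaddConcl N f b fun Λs => ∀ k, RelConn A (↑(Λs k) : Set (V d)) := by
  set l : EReal := ⨅ k : {n : ℕ // 0 < n ∧ N ∣ n},
    (((f (boxF d (k : ℕ)) + b (boxF d (k : ℕ))) / ((k : ℕ) : ℝ) ^ d : ℝ) : EReal) with hl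
  have hle : ∀ n : ℕ, 0 < n → N ∣ n →
      l ≤ (((f (boxF d n) + b (boxF d n)) / (n : ℝ) ^ d : ℝ) : EReal) :=
    fun n h1 h2 => iInf_le (fun k : {n : ℕ // 0 < n ∧ N ∣ n} =>
      (((f (boxF d (k : ℕ)) + b (boxF d (k : ℕ))) / ((k : ℕ) : ℝ) ^ d : ℝ) : EReal)) ⟨n, h1, h2⟩
  have hltop : l ≠ ⊤ := ((hle N hN dvd_rfl).trans_lt (EReal.coe_lt_top _)).ne
  have hupper : ∀ Λs : ℕ → Finset (V d), VanHove Λs →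
      (∀ k, RelConn A (↑(Λs k) : Set (V d))) →
      limsup (fun n => ((f (Λs n) / ((Λs n).card : ℝ) : ℝ) : EReal)) atTop ≤ l :=
    fun Λs hΛ hconn => le_iInf fun k =>
      hf.limsup_le k.2.2 k.2.1 hN hL hfinv hb hΛ hconn
  refine ⟨l, hltop, ?_, hl, hupper⟩
  have hboxes := hupper (boxF d) (vanHove_boxF hd) fun k => (connSet_boxF d k).relConn hA
  simp only [card_boxF, Nat.cast_pow] at hboxes
  refine tendsto_of_le_liminf_of_limsup_le ?_ hboxes
  rcases eq_or_ne l ⊥ with hbot | hbot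
  · rw [hbot]
    exact bot_le
  lift l to ℝ using ⟨hltop, hbot⟩ with l₀
  obtain ⟨hb0, hbinv, -, hbam⟩ := hb
  obtain ⟨C, hC0, hC⟩ := exists_singleton_bound hN hL (g := fun Λ => f Λ + b Λ)
    fun z hz Λ => by rw [hfinv z hz, hbinv z hz]
  set m : ℕ → ℕ := fun k => N * (k / N + 1) with hm
  have hkm : ∀ k, k ≤ m k := fun k => (Nat.lt_mul_div_succ k hN).le
  have hmk : ∀ k, m k ≤ k + N := fun k => by
    have := Nat.mul_div_le k N
    simp only [hm, mul_add]
    omega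
  have hratio : Tendsto (fun k : ℕ => ((m k : ℝ) / k) ^ d) atTop (nhds 1) := by
    refine tendsto_of_tendsto_of_tendsto_of_le_of_le' tendsto_const_nhds
      (tendsto_add_div_pow_one N d) ?_ ?_
    · filter_upwards [eventually_gt_atTop 0] with k hk
      refine one_le_pow₀ ((one_le_div (by positivity)).2 ?_)
      exact_mod_cast hkm k
    · filter_upwards [eventually_gt_atTop 0] with k hk
      gcongr
      exact_mod_cast hmk k
  have hbm : Tendsto (fun k : ℕ => b (boxF d (m k)) / (m k : ℝ) ^ d) atTop (nhds 0) := by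
    have h := (hbam _ (vanHove_boxF hd)).comp (tendsto_atTop_mono hkm tendsto_id)
    simpa only [Function.comp_def, card_boxF, Nat.cast_pow] using h
  have hlim : Tendsto (fun k : ℕ => l₀ * ((m k : ℝ) / k) ^ d -
      b (boxF d (m k)) / (m k : ℝ) ^ d * ((m k : ℝ) / k) ^ d - C * (((m k : ℝ) / k) ^ d - 1))
      atTop (nhds l₀) := by
    simpa using ((hratio.const_mul l₀).sub (hbm.mul hratio)).sub
      ((hratio.sub_const 1).const_mul C)
  refine le_trans (EReal.tendsto_coe.2 hlim).liminf_eq.ge (liminf_le_liminf ?_)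
  filter_upwards [eventually_gt_atTop 0] with k hk
  have hm0 : 0 < m k := hk.trans_le (hkm k)
  have h1 := hle (m k) hm0 (dvd_mul_right _ _)
  have h2 := hf.boxF_le hA hC hk (hkm k)
  have hkd : (0 : ℝ) < (k : ℝ) ^ d := by positivity
  have hmd : (0 : ℝ) < (m k : ℝ) ^ d := by positivity
  rw [EReal.coe_le_coe_iff, le_div_iff₀ hmd] at h1
  rw [EReal.coe_le_coe_iff, le_div_iff₀ hkd, div_pow]
  have h3 : (l₀ * ((m k : ℝ) ^ d / (k : ℝ) ^ d) -
      b (boxF d (m k)) / (m k : ℝ) ^ d * ((m k : ℝ) ^ d / (k : ℝ) ^ d) -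
      C * ((m k : ℝ) ^ d / (k : ℝ) ^ d - 1)) * (k : ℝ) ^ d =
      l₀ * (m k : ℝ) ^ d - b (boxF d (m k)) - C * ((m k : ℝ) ^ d - (k : ℝ) ^ d) := by
    field_simp
  rw [h3]
  linarith

/-- density limits of subadditive invariant functions. -/
theorem statement14 (d : ℕ) (hd : 1 ≤ d) (L : AddSubgroup (V d))
    (hL : ∃ N : ℕ, 0 < N ∧ ∀ x : V d, (N : ℤ) • x ∈ L)
    (N : ℕ) (hN : 0 < N ∧ (∀ x : V d, (N : ℤ) • x ∈ L) ∧
      ∀ M : ℕ, 0 < M → (∀ x : V d, (M : ℤ) • x ∈ L) → N ≤ M)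
    (f b : Finset (V d) → ℝ)
    (hfinv : ∀ z ∈ L, ∀ Λ : Finset (V d), f (Λ.image (· + z)) = f Λ)
    (hb : Amenable L b) :
    ((∀ Λ Δ : Finset (V d), Disjoint Λ Δ →
        f (Λ ∪ Δ) ≤ f Λ + f Δ + min (b Λ) (b Δ)) →
      SubaddConcl N f b fun _ => True) ∧
    ((∀ Λ Δ : Finset (V d), Disjoint Λ Δ → (∃ x ∈ Λ, ∃ y ∈ Δ, adj1 x y) →
        f (Λ ∪ Δ) ≤ f Λ + f Δ + min (b Λ) (b Δ)) →
      SubaddConcl N f b fun Λs => ∀ n, ConnSet (↑(Λs n) : Set (V d))) := by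
  constructor
  · intro h
    obtain ⟨l, h1, h2, h3, h4⟩ := RelSubadd.subaddConcl hd hN.1 hN.2.1
      (A := fun _ _ => True) (fun _ _ _ => trivial) (fun Λ Δ hd' _ => h Λ Δ hd') hfinv hb
    exact ⟨l, h1, h2, h3, fun Λs hΛ _ => h4 Λs hΛ fun k x hx y hy =>
      Relation.ReflTransGen.single ⟨hx, hy, trivial⟩⟩
  · intro h
    exact RelSubadd.subaddConcl hd hN.1 hN.2.1 (A := adj1) (fun _ _ => id) h hfinv hb

end
end

section
/- Let D ⊆ ℝ^d be bounded, convex, and of positive Lebesgue measure, let m ∈ ℤ_{≥0}, and let (D_i, m_i)_i be a finite family where the D_i are disjoint bounded convex subsets of D of positive Lebesgue measure and the m_i ≥ m are nonnegative integers. Set Λ_n := Λ^{−m}(nD) and Λ_n^i := Λ^{−m_i}(nD_i). Then for every cylinder function f: Ω → [0,1], limsup_{n→∞} sup_{φ∈Ω} | L_{Λ_n}(φ)(f) − Σ_i (Leb(D_i)/Leb(D))·L_{Λ_n^i}(φ)(f) | ≤ Leb(D ∖ ∪_i D_i)/Leb(D). -/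
open MeasureTheory Filter Set
open scoped Classical ENNReal

noncomputable section

/-- Height functions `ℤ^d → E`. -/
abbrev Config (d : ℕ) (E : Type*) := V d → E

/-- The shift `θ_z`. -/
def shift {d : ℕ} {E : Type*} (z : V d) (φ : Config d E) : Config d E := fun y => φ (y + z)

/-- The lexicographic (dictionary) strict order on `ℤ^d`. -/
def lexLt {d : ℕ} (x y : V d) : Prop :=
  ∃ i : Fin d, (∀ j : Fin d, j < i → x j = y j) ∧ x i < y i

/-- `x` is the lexicographically least element of `s`. -/
def IsLexLeast {d : ℕ} (s : Set (V d)) (x : V d) : Prop :=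
  x ∈ s ∧ ∀ y ∈ s, x = y ∨ lexLt x y

/-- The lexicographically least element (`0_Λ`). -/
def lexLeast {d : ℕ} (s : Set (V d)) : V d :=
  if h : ∃ x, IsLexLeast s x then h.choose else 0

/-- `φ̄_Λ`: the extension of `φ|_Λ` by the constant `φ(0_Λ)` off `Λ`. -/
def flatten {d : ℕ} {E : Type*} (s : Set (V d)) (φ : Config d E) : Config d E :=
  fun y => if y ∈ s then φ y else φ (lexLeast s)

/-- `L_Λ(φ)(f)`: the integral of `f` against the empirical measure of `φ` in `Λ`. -/
def empAvg {d : ℕ} {E : Type*} (L : AddSubgroup (V d)) (s : Set (V d)) (φ : Config d E)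
    (f : Config d E → ℝ) : ℝ :=
  (∑ᶠ x ∈ s ∩ (L : Set (V d)), f (shift x (flatten s φ))) /
    ((s ∩ (L : Set (V d))).ncard : ℝ)

/-- Embed a lattice point into `ℝ^d`. -/
def embR {d : ℕ} (x : V d) : Fin d → ℝ := fun i => (x i : ℝ)

/-- The lattice points in a region of `ℝ^d`. -/
def latticeIn {d : ℕ} (D : Set (Fin d → ℝ)) : Set (V d) := {x | embR x ∈ D}

/-- Remove all vertices within distance `m` of the complement. -/
def erode {d : ℕ} (s : Set (V d)) (m : ℕ) : Set (V d) :=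
  {x | x ∈ s ∧ ∀ y : V d, dist1 x y ≤ m → y ∈ s}

/-- `Λ^{-m}(nD)`. -/
def lamSet {d : ℕ} (m n : ℕ) (D : Set (Fin d → ℝ)) : Set (V d) :=
  erode (latticeIn ((fun x => (n : ℝ) • x) '' D)) m

/-- The local σ-algebra `F_Δ`. -/
def locAlg (d : ℕ) (E : Type*) [MeasurableSpace E] (Δ : Set (V d)) :
    MeasurableSpace (Config d E) :=
  ⨆ (x : V d) (_ : x ∈ Δ), MeasurableSpace.comap (fun φ : Config d E => φ x) inferInstance

/-- Cylinder functions. -/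
def Cyl {d : ℕ} {E : Type*} [MeasurableSpace E] (f : Config d E → ℝ) : Prop :=
  ∃ Δ : Finset (V d), @Measurable _ _ (locAlg d E (↑Δ : Set (V d))) _ f

/-- Statement 15 for a fixed height space `E`. -/
def Stmt15 (E : Type*) [MeasurableSpace E] [Inhabited E] : Prop :=
  ∀ (d : ℕ), 1 ≤ d → ∀ L : AddSubgroup (V d),
    (∃ N : ℕ, 0 < N ∧ ∀ x : V d, (N : ℤ) • x ∈ L) →
  ∀ D : Set (Fin d → ℝ), Bornology.IsBounded D → Convex ℝ D → 0 < volume D →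
  ∀ m : ℕ, ∀ (ι : Type) (_ : Fintype ι) (Ds : ι → Set (Fin d → ℝ)) (ms : ι → ℕ),
    (∀ i, Bornology.IsBounded (Ds i) ∧ Convex ℝ (Ds i) ∧ 0 < volume (Ds i) ∧ Ds i ⊆ D) →
    (∀ i j, i ≠ j → Disjoint (Ds i) (Ds j)) → (∀ i, m ≤ ms i) →
  ∀ f : Config d E → ℝ, Cyl f → (∀ φ, 0 ≤ f φ ∧ f φ ≤ 1) →
    limsup (fun n : ℕ =>
        ⨆ φ : Config d E, |empAvg L (lamSet m n D) φ f -
          ∑ i, ((volume (Ds i)).toReal / (volume D).toReal) *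
            empAvg L (lamSet (ms i) n (Ds i)) φ f|)
      atTop ≤ (volume (D \ ⋃ i, Ds i)).toReal / (volume D).toReal


open scoped Topology Pointwise

/-- The embedding `ℤ^d → ℝ^d` as an additive homomorphism. -/
def embHom (d : ℕ) : V d →+ (Fin d → ℝ) where
  toFun := embR
  map_zero' := by ext i; simp [embR]
  map_add' x y := by ext i; simp [embR]

theorem embR_injective {d : ℕ} : Function.Injective (embR (d := d)) := by
  intro x y h
  ext i
  have := congrFun h i
  simpa [embR] using this

/-- The image of a subgroup of `ℤ^d` in `ℝ^d`. -/
def realLattice {d : ℕ} (L : AddSubgroup (V d)) : Submodule ℤ (Fin d → ℝ) :=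
  AddSubgroup.toIntSubmodule (L.map (embHom d))

theorem coe_realLattice {d : ℕ} (L : AddSubgroup (V d)) :
    (realLattice L : Set (Fin d → ℝ)) = embR '' (L : Set (V d)) := rfl

theorem realLattice_le_span {d : ℕ} (L : AddSubgroup (V d)) :
    realLattice L ≤ Submodule.span ℤ (Set.range (Pi.basisFun ℝ (Fin d))) := by
  intro x hx
  obtain ⟨y, -, rfl⟩ : x ∈ embR '' (L : Set (V d)) := hx
  rw [Module.Basis.mem_span_iff_repr_mem]
  intro i
  exact ⟨y i, by simp [embR]⟩

instance instDiscreteTopologyRealLattice {d : ℕ} (L : AddSubgroup (V d)) :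
    DiscreteTopology (realLattice L) :=
  DiscreteTopology.of_subset
    (inferInstance : DiscreteTopology (Submodule.span ℤ (Set.range (Pi.basisFun ℝ (Fin d)))))
    (realLattice_le_span L)

theorem isZLattice_realLattice {d : ℕ} {L : AddSubgroup (V d)}
    (hL : ∃ N : ℕ, 0 < N ∧ ∀ x : V d, (N : ℤ) • x ∈ L) : IsZLattice ℝ (realLattice L) := by
  obtain ⟨N, hN, h⟩ := hL
  refine ⟨?_⟩
  rw [eq_top_iff, ← (Pi.basisFun ℝ (Fin d)).span_eq, Submodule.span_le]
  rintro _ ⟨i, rfl⟩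
  have h1 : embR ((N : ℤ) • (Pi.single i 1 : V d)) ∈
      Submodule.span ℝ (realLattice L : Set (Fin d → ℝ)) :=
    Submodule.subset_span ⟨_, h _, rfl⟩
  have h2 : (Pi.basisFun ℝ (Fin d)) i =
      (N : ℝ)⁻¹ • embR ((N : ℤ) • (Pi.single i 1 : V d)) := by
    ext j
    have : (N : ℝ) ≠ 0 := by positivity
    by_cases hij : j = i
    · subst hij; simp [embR, this]
    · simp [embR, hij]
  rw [SetLike.mem_coe, h2]
  exact Submodule.smul_mem _ _ h1

theorem natCard_inter_smul_realLattice {d : ℕ} (L : AddSubgroup (V d)) (s : Set (Fin d → ℝ))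
    {n : ℕ} (hn : 0 < n) :
    Nat.card (s ∩ (n : ℝ)⁻¹ • (realLattice L : Set (Fin d → ℝ)) : Set (Fin d → ℝ)) =
      {x | x ∈ L ∧ (n : ℝ)⁻¹ • embR x ∈ s}.ncard := by
  have hn' : (n : ℝ)⁻¹ ≠ 0 := by positivity
  rw [Nat.card_coe_set_eq, ← Set.ncard_image_of_injective (f := fun x => (n : ℝ)⁻¹ • embR x)]
  · congr 1
    ext y
    simp only [coe_realLattice, Set.mem_inter_iff, Set.mem_smul_set, Set.mem_image, Set.mem_ofPred_eq,
      SetLike.mem_coe]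
    constructor
    · rintro ⟨hy, _, ⟨x, hx, rfl⟩, rfl⟩
      exact ⟨x, ⟨hx, hy⟩, rfl⟩
    · rintro ⟨x, ⟨hx, hy⟩, rfl⟩
      exact ⟨hy, _, ⟨x, hx, rfl⟩, rfl⟩
  · exact (smul_right_injective _ hn').comp embR_injective

theorem tendsto_ncard_div_pow {d : ℕ} {L : AddSubgroup (V d)}
    (hL : ∃ N : ℕ, 0 < N ∧ ∀ x : V d, (N : ℤ) • x ∈ L) {s : Set (Fin d → ℝ)}
    (hb : Bornology.IsBounded s) (hm : MeasurableSet s) (hc : Convex ℝ s) :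
    Tendsto (fun n : ℕ => ({x | x ∈ L ∧ (n : ℝ)⁻¹ • embR x ∈ s}.ncard : ℝ) / (n : ℝ) ^ d) atTop
      (𝓝 (volume.real s / ZLattice.covolume (realLattice L))) := by
  have := isZLattice_realLattice hL
  have b : Module.Basis (Fin d) ℤ (realLattice L) :=
    Module.finBasisOfFinrankEq _ _ (by rw [ZLattice.rank ℝ (realLattice L)]; simp)
  have h := ZLattice.covolume.tendsto_card_div_pow (realLattice L) b hb hm
    (hc.addHaar_frontier volume)
  rw [Fintype.card_fin] at h
  refine h.congr' ?_
  filter_upwards [eventually_gt_atTop 0] with n hn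
  rw [natCard_inter_smul_realLattice L s hn]

theorem finite_setOf_smul_embR_mem {d : ℕ} {s : Set (Fin d → ℝ)} (hb : Bornology.IsBounded s)
    {n : ℕ} (hn : 0 < n) : {x : V d | (n : ℝ)⁻¹ • embR x ∈ s}.Finite := by
  obtain ⟨R, hR⟩ := hb.subset_closedBall 0
  have hn' : (0 : ℝ) < n := by positivity
  refine (Set.Finite.pi' (fun _ : Fin d => Set.finite_Icc (-⌈n * R⌉) ⌈n * R⌉)).subset ?_
  intro x hx i
  have h1 := hR hx
  rw [mem_closedBall_zero_iff] at h1
  have h2 := (norm_le_pi_norm _ i).trans h1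
  simp only [Pi.smul_apply, embR, smul_eq_mul, norm_mul, norm_inv,
    Real.norm_eq_abs, abs_of_pos hn'] at h2
  rw [inv_mul_le_iff₀ hn', abs_le] at h2
  have h3 := Int.le_ceil ((n : ℝ) * R)
  constructor
  · have : ((-⌈n * R⌉ : ℤ) : ℝ) ≤ x i := by push_cast; linarith
    exact_mod_cast this
  · have : (x i : ℝ) ≤ (⌈n * R⌉ : ℤ) := by linarith
    exact_mod_cast this

theorem mem_latticeIn_smul_iff {d n : ℕ} (hn : 0 < n) (D : Set (Fin d → ℝ)) (x : V d) :
    x ∈ latticeIn ((fun x => (n : ℝ) • x) '' D) ↔ (n : ℝ)⁻¹ • embR x ∈ D := by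
  have hn' : (n : ℝ) ≠ 0 := by positivity
  constructor
  · rintro ⟨y, hy, h⟩
    rw [← h]
    simpa [smul_smul, hn'] using hy
  · intro h
    exact ⟨_, h, by simp [smul_smul, hn']⟩

theorem lamSet_subset {d m n : ℕ} (hn : 0 < n) (D : Set (Fin d → ℝ)) :
    lamSet m n D ⊆ {x | (n : ℝ)⁻¹ • embR x ∈ D} := fun x hx =>
  (mem_latticeIn_smul_iff hn D x).1 hx.1

theorem finite_lamSet {d m n : ℕ} (hn : 0 < n) {D : Set (Fin d → ℝ)}
    (hb : Bornology.IsBounded D) : (lamSet m n D).Finite :=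
  (finite_setOf_smul_embR_mem hb hn).subset (lamSet_subset hn D)

theorem lamSet_mono {d m k n : ℕ} {D D' : Set (Fin d → ℝ)} (hmk : m ≤ k) (hD : D' ⊆ D) :
    lamSet k n D' ⊆ lamSet m n D := by
  have h : latticeIn ((fun x => (n : ℝ) • x) '' D') ⊆ latticeIn ((fun x => (n : ℝ) • x) '' D) :=
    fun x hx => Set.image_mono hD hx
  exact fun x hx => ⟨h hx.1, fun y hy => h (hx.2 y (hy.trans hmk))⟩

theorem dist1_triangle {d : ℕ} (x y z : V d) : dist1 x z ≤ dist1 x y + dist1 y z := by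
  unfold dist1
  rw [← Finset.sum_add_distrib]
  exact Finset.sum_le_sum fun i _ => by omega

theorem mem_lamSet_of_dist1_le {d m k n : ℕ} {D : Set (Fin d → ℝ)} {x y : V d}
    (hx : x ∈ lamSet (m + k) n D) (hxy : dist1 x y ≤ k) : y ∈ lamSet m n D :=
  ⟨hx.2 y (by omega), fun z hz => hx.2 z (by have := dist1_triangle x y z; omega)⟩

theorem dist_embR_le {d : ℕ} (x y : V d) : dist (embR x) (embR y) ≤ dist1 x y := by
  refine (dist_pi_le_iff (by positivity)).2 fun i => ?_
  have h : (x i - y i).natAbs ≤ dist1 x y :=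
    Finset.single_le_sum (f := fun i => (x i - y i).natAbs) (fun _ _ => Nat.zero_le _)
      (Finset.mem_univ i)
  have h' : (((x i - y i).natAbs : ℕ) : ℝ) ≤ dist1 x y := by exact_mod_cast h
  rw [Nat.cast_natAbs] at h'
  simpa [Real.dist_eq, embR] using h'

theorem mem_lamSet_of_cthickening_subset {d m n : ℕ} (hn : 0 < n) {K D : Set (Fin d → ℝ)} {δ : ℝ}
    (hK : Metric.cthickening δ K ⊆ D) (hδ : (m : ℝ) ≤ n * δ) {x : V d}
    (hx : (n : ℝ)⁻¹ • embR x ∈ K) : x ∈ lamSet m n D := by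
  have key : ∀ y : V d, dist1 x y ≤ m → y ∈ latticeIn ((fun x => (n : ℝ) • x) '' D) := by
    intro y hy
    rw [mem_latticeIn_smul_iff hn]
    refine hK (Metric.mem_cthickening_of_dist_le _ _ _ _ hx ?_)
    have hn' : (0 : ℝ) < n := by positivity
    rw [dist_smul₀, norm_inv, Real.norm_natCast, inv_mul_le_iff₀ hn', dist_comm]
    refine (dist_embR_le x y).trans (le_trans ?_ hδ)
    exact_mod_cast hy
  exact ⟨key x (by simp [dist1]), key⟩

theorem tendsto_ncard_lamSet {d : ℕ} {L : AddSubgroup (V d)}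
    (hL : ∃ N : ℕ, 0 < N ∧ ∀ x : V d, (N : ℤ) • x ∈ L) {D : Set (Fin d → ℝ)}
    (hb : Bornology.IsBounded D) (hc : Convex ℝ D) (hv : 0 < volume D) (m : ℕ) :
    Tendsto (fun n : ℕ => ((lamSet m n D ∩ (L : Set (V d))).ncard : ℝ) / (n : ℝ) ^ d) atTop
      (𝓝 (volume.real D / ZLattice.covolume (realLattice L))) := by
  have := isZLattice_realLattice hL
  have hcl : volume (closure D) = volume D :=
    measure_congr (closure_ae_eq_of_null_frontier (hc.addHaar_frontier volume))
  have hin : volume (interior D) = volume D :=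
    measure_congr (interior_ae_eq_of_null_frontier (hc.addHaar_frontier volume))
  have hclr : volume.real (closure D) = volume.real D := by simp [measureReal_def, hcl]
  obtain ⟨x₀, hx₀⟩ : (interior D).Nonempty :=
    nonempty_of_measure_ne_zero (μ := volume) (by rw [hin]; exact hv.ne')
  have hcov := ZLattice.covolume_pos (realLattice L) volume
  rw [tendsto_order]
  constructor
  · intro a ha
    have hlim : Tendsto (fun t : ℝ => t ^ d * volume.real D /
        ZLattice.covolume (realLattice L)) (𝓝[<] 1)
        (𝓝 (volume.real D / ZLattice.covolume (realLattice L))) := by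
      have : ContinuousAt (fun t : ℝ => t ^ d * volume.real D /
        ZLattice.covolume (realLattice L)) 1 := by fun_prop
      have h := this.tendsto.mono_left (nhdsWithin_le_nhds (s := Set.Iio 1))
      simpa using h
    obtain ⟨t, hta, ht0, ht1⟩ := ((hlim.eventually (lt_mem_nhds ha)).and
      (Ioo_mem_nhdsLT (show (0 : ℝ) < 1 by norm_num))).exists
    set K := AffineMap.homothety x₀ t '' closure D with hKdef
    have hKcpt : IsCompact K := hb.isCompact_closure.image
      (AffineMap.homothety_continuous x₀ t)
    have hKsub : K ⊆ interior D := by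
      rintro _ ⟨y, hy, rfl⟩
      refine hc.openSegment_interior_closure_subset_interior hx₀ hy ?_
      rw [openSegment_eq_image_lineMap]
      exact ⟨t, ⟨ht0, ht1⟩, by rw [AffineMap.homothety_eq_lineMap]⟩
    have hKconv : Convex ℝ K := hc.closure.affine_image _
    have hKvol : volume.real K = t ^ d * volume.real D := by
      rw [measureReal_def, hKdef, Measure.addHaar_image_homothety, hcl, ENNReal.toReal_mul,
        ENNReal.toReal_ofReal (abs_nonneg _), Module.finrank_fin_fun, abs_of_pos (by positivity)]
      rfl
    obtain ⟨δ, hδ, hKδ⟩ := hKcpt.exists_cthickening_subset_open isOpen_interior hKsub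
    have hlimK := tendsto_ncard_div_pow hL hKcpt.isBounded hKcpt.measurableSet hKconv
    rw [hKvol] at hlimK
    have hδn : ∀ᶠ n : ℕ in atTop, (m : ℝ) ≤ n * δ :=
      (tendsto_natCast_atTop_atTop.atTop_mul_const hδ).eventually_ge_atTop _
    filter_upwards [hlimK.eventually (lt_mem_nhds hta), hδn, eventually_gt_atTop 0] with n h1 h2 h3
    refine h1.trans_le ?_
    gcongr
    · exact (finite_lamSet h3 hb).inter_of_left _
    · exact fun x hx =>
        ⟨mem_lamSet_of_cthickening_subset h3 (hKδ.trans interior_subset) h2 hx.2, hx.1⟩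
  · intro a ha
    have hlim := tendsto_ncard_div_pow hL hb.closure measurableSet_closure hc.closure
    rw [hclr] at hlim
    filter_upwards [hlim.eventually (gt_mem_nhds ha), eventually_gt_atTop 0] with n h1 h3
    refine lt_of_le_of_lt ?_ h1
    gcongr
    · exact (finite_setOf_smul_embR_mem hb.closure h3).subset fun x hx => hx.2
    · exact fun x hx => ⟨hx.2, subset_closure (lamSet_subset h3 D hx.1)⟩

/-- The subsets of configuration space that are invariant under changing values off `Δ`. -/
def localSets (d : ℕ) (E : Type*) (Δ : Set (V d)) : MeasurableSpace (Config d E) where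
  MeasurableSet' A := ∀ φ ψ : Config d E, (∀ x ∈ Δ, φ x = ψ x) → (φ ∈ A ↔ ψ ∈ A)
  measurableSet_empty := by simp
  measurableSet_compl A hA φ ψ h := by simp [hA φ ψ h]
  measurableSet_iUnion A hA φ ψ h := by simp [fun i => hA i φ ψ h]

theorem locAlg_le_localSets (d : ℕ) (E : Type*) [MeasurableSpace E] (Δ : Set (V d)) :
    locAlg d E Δ ≤ localSets d E Δ := by
  refine iSup₂_le fun x hx => ?_
  rintro _ ⟨B, -, rfl⟩ φ ψ h
  simp [h x hx]

theorem Cyl.exists_eq_of_eqOn {d : ℕ} {E : Type*} [MeasurableSpace E] {f : Config d E → ℝ}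
    (hf : Cyl f) : ∃ Δ : Finset (V d), ∀ φ ψ : Config d E, (∀ x ∈ Δ, φ x = ψ x) → f φ = f ψ := by
  obtain ⟨Δ, hΔ⟩ := hf
  refine ⟨Δ, fun φ ψ h => ?_⟩
  have h1 := locAlg_le_localSets d E _ _ (hΔ (measurableSet_singleton (f φ))) φ ψ h
  simpa [eq_comm] using h1

theorem sum_sub_sum_mem_Icc {α : Type*} {s t : Finset α} (hst : s ⊆ t) {F : α → ℝ}
    (hF : ∀ x, 0 ≤ F x ∧ F x ≤ 1) :
    ∑ x ∈ t, F x - ∑ x ∈ s, F x ∈ Set.Icc (0 : ℝ) (t.card - s.card) := by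
  have h1 := Finset.sum_sdiff (f := F) hst
  have h2 : ∑ x ∈ t \ s, F x ≤ ((t \ s).card : ℝ) := by
    simpa using Finset.sum_le_sum fun x (_ : x ∈ t \ s) => (hF x).2
  have h3 : 0 ≤ ∑ x ∈ t \ s, F x := Finset.sum_nonneg fun x _ => (hF x).1
  rw [Finset.cast_card_sdiff hst] at h2
  constructor <;> linarith

theorem abs_div_sub_mul_div_le {a b c g T w : ℝ} (ha : 0 < a) (hb : 0 < b) (hw : 0 ≤ w)
    (hg : 0 ≤ g) (hgc : g ≤ c) (hcb : c ≤ b) (hT : 0 ≤ T - g) (hT' : T - g ≤ b - c) :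
    |g / a - w * (T / b)| ≤ |b / a - w| + w * (1 - c / b) := by
  have e : g / a - w * (T / b) = g / b * (b / a - w) - w * ((T - g) / b) := by
    field_simp
    ring
  rw [e]
  refine (abs_sub _ _).trans (add_le_add ?_ ?_)
  · rw [abs_mul, abs_of_nonneg (by positivity)]
    exact mul_le_of_le_one_left (abs_nonneg _) ((div_le_one hb).2 (hgc.trans hcb))
  · rw [abs_of_nonneg (by positivity)]
    refine mul_le_mul_of_nonneg_left ?_ hw
    rw [one_sub_div hb.ne']
    gcongr

/-- Comparison of an average over `A` with a weighted combination of averages over the `B i`,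
when the summands agree on disjoint sets `G i` contained in both. -/
theorem abs_avg_sub_sum_avg_le {α ι : Type*} [Fintype ι] {A : Finset α} {B G : ι → Finset α}
    (hGA : ∀ i, G i ⊆ A) (hGB : ∀ i, G i ⊆ B i) (hG : ∀ i j, i ≠ j → Disjoint (G i) (G j))
    {F : α → ℝ} {H : ι → α → ℝ} (hF : ∀ x, 0 ≤ F x ∧ F x ≤ 1) (hH : ∀ i x, 0 ≤ H i x ∧ H i x ≤ 1)
    (hFH : ∀ i, ∀ x ∈ G i, H i x = F x) {w : ι → ℝ} (hw : ∀ i, 0 ≤ w i) (hA : 0 < A.card)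
    (hB : ∀ i, 0 < (B i).card) :
    |(∑ x ∈ A, F x) / A.card - ∑ i, w i * ((∑ x ∈ B i, H i x) / (B i).card)| ≤
      (1 - ∑ i, ((G i).card : ℝ) / A.card) +
        ∑ i, (|((B i).card : ℝ) / A.card - w i| + w i * (1 - ((G i).card : ℝ) / (B i).card)) := by
  have hA' : (0 : ℝ) < A.card := by exact_mod_cast hA
  have hR := sum_sub_sum_mem_Icc (s := Finset.univ.biUnion G)
    (Finset.biUnion_subset.2 fun i _ => hGA i) hF
  have hdisj : Set.PairwiseDisjoint (↑(Finset.univ : Finset ι)) G := fun i _ j _ hij => hG i j hij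
  rw [Finset.sum_biUnion hdisj, Finset.card_biUnion fun i _ j _ hij => hG i j hij] at hR
  push_cast at hR
  have e : (∑ x ∈ A, F x) / A.card - ∑ i, w i * ((∑ x ∈ B i, H i x) / (B i).card) =
      (∑ x ∈ A, F x - ∑ i, ∑ x ∈ G i, F x) / A.card +
        ∑ i, ((∑ x ∈ G i, F x) / A.card - w i * ((∑ x ∈ B i, H i x) / (B i).card)) := by
    rw [Finset.sum_sub_distrib, ← Finset.sum_div]
    ring
  rw [e]
  refine (abs_add_le _ _).trans (add_le_add ?_ ?_)
  · rw [abs_of_nonneg (div_nonneg hR.1 hA'.le), ← Finset.sum_div, one_sub_div hA'.ne']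
    exact div_le_div_of_nonneg_right hR.2 hA'.le
  · refine (Finset.abs_sum_le_sum_abs _ _).trans (Finset.sum_le_sum fun i _ => ?_)
    have h1 := sum_sub_sum_mem_Icc (hGB i) (hH i)
    rw [Finset.sum_congr rfl (hFH i)] at h1
    refine abs_div_sub_mul_div_le hA' (by exact_mod_cast hB i) (hw i)
      (Finset.sum_nonneg fun x _ => (hF x).1) ?_ ?_ h1.1 h1.2
    · simpa using Finset.sum_le_sum fun x (_ : x ∈ G i) => (hF x).2
    · exact_mod_cast Finset.card_le_card (hGB i)

theorem shift_flatten_eq {d : ℕ} {E : Type*} {m k n : ℕ} {D : Set (Fin d → ℝ)} {s : Set (V d)}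
    (hs : lamSet m n D ⊆ s) {x y : V d} (hx : x ∈ lamSet (m + k) n D) (hy : dist1 0 y ≤ k)
    (φ : Config d E) : shift x (flatten s φ) y = φ (y + x) := by
  have hxy : dist1 x (y + x) ≤ k := by
    refine le_trans (le_of_eq ?_) hy
    simp [dist1]
  exact if_pos (hs (mem_lamSet_of_dist1_le hx hxy))

theorem empAvg_eq_sum_div {d : ℕ} {E : Type*} (L : AddSubgroup (V d)) {s : Set (V d)}
    (hs : s.Finite) (φ : Config d E) (f : Config d E → ℝ) :
    empAvg L s φ f =
      (∑ x ∈ (hs.inter_of_left (L : Set (V d))).toFinset, f (shift x (flatten s φ))) /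
        ((hs.inter_of_left (L : Set (V d))).toFinset.card : ℝ) := by
  rw [empAvg, finsum_mem_eq_finite_toFinset_sum _ (hs.inter_of_left _),
    Set.ncard_eq_toFinset_card _ (hs.inter_of_left _)]

theorem abs_empAvg_sub_sum_le {d : ℕ} {E : Type*} (L : AddSubgroup (V d))
    {D : Set (Fin d → ℝ)} (hb : Bornology.IsBounded D) {m : ℕ} {ι : Type*} [Fintype ι]
    {Ds : ι → Set (Fin d → ℝ)} {ms : ι → ℕ} (hDs : ∀ i, Ds i ⊆ D)
    (hdisj : ∀ i j, i ≠ j → Disjoint (Ds i) (Ds j)) (hms : ∀ i, m ≤ ms i)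
    {f : Config d E → ℝ} (hf : ∀ φ, 0 ≤ f φ ∧ f φ ≤ 1) {Δ : Finset (V d)}
    (hΔ : ∀ φ ψ : Config d E, (∀ x ∈ Δ, φ x = ψ x) → f φ = f ψ) {k : ℕ}
    (hk : ∀ y ∈ Δ, dist1 0 y ≤ k) {w : ι → ℝ} (hw : ∀ i, 0 ≤ w i) {n : ℕ} (hn : 0 < n)
    (hA : 0 < (lamSet m n D ∩ (L : Set (V d))).ncard)
    (hB : ∀ i, 0 < (lamSet (ms i) n (Ds i) ∩ (L : Set (V d))).ncard) (φ : Config d E) :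
    |empAvg L (lamSet m n D) φ f - ∑ i, w i * empAvg L (lamSet (ms i) n (Ds i)) φ f| ≤
      (1 - ∑ i, ((lamSet (ms i + k) n (Ds i) ∩ (L : Set (V d))).ncard : ℝ) /
          (lamSet m n D ∩ (L : Set (V d))).ncard) +
        ∑ i, (|((lamSet (ms i) n (Ds i) ∩ (L : Set (V d))).ncard : ℝ) /
            (lamSet m n D ∩ (L : Set (V d))).ncard - w i| +
          w i * (1 - ((lamSet (ms i + k) n (Ds i) ∩ (L : Set (V d))).ncard : ℝ) /
            (lamSet (ms i) n (Ds i) ∩ (L : Set (V d))).ncard)) := by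
  have hAf : (lamSet m n D).Finite := finite_lamSet hn hb
  have hBf : ∀ i, (lamSet (ms i) n (Ds i)).Finite := fun i => finite_lamSet hn (hb.subset (hDs i))
  have hGf : ∀ i, (lamSet (ms i + k) n (Ds i)).Finite := fun i =>
    finite_lamSet hn (hb.subset (hDs i))
  have hBA : ∀ i, lamSet (ms i) n (Ds i) ⊆ lamSet m n D := fun i => lamSet_mono (hms i) (hDs i)
  have hGB : ∀ i, lamSet (ms i + k) n (Ds i) ⊆ lamSet (ms i) n (Ds i) := fun i =>
    lamSet_mono (Nat.le_add_right _ _) subset_rfl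
  have eB := fun i => empAvg_eq_sum_div L (hBf i) φ f
  have cA := Set.ncard_eq_toFinset_card _ (hAf.inter_of_left (L : Set (V d)))
  have cB := fun i => Set.ncard_eq_toFinset_card _ ((hBf i).inter_of_left (L : Set (V d)))
  have cG := fun i => Set.ncard_eq_toFinset_card _ ((hGf i).inter_of_left (L : Set (V d)))
  rw [cA] at hA
  simp only [cB] at hB
  simp only [empAvg_eq_sum_div L hAf φ f, eB, cA, cB, cG]
  refine abs_avg_sub_sum_avg_le (fun i => ?_) (fun i => ?_) (fun i j hij => ?_) (fun x => hf _)
    (fun i x => hf _) (fun i x hx => hΔ _ _ fun y hy => ?_) hw hA hB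
  · exact Set.Finite.toFinset_subset_toFinset.2
      (Set.inter_subset_inter_left _ ((hGB i).trans (hBA i)))
  · exact Set.Finite.toFinset_subset_toFinset.2 (Set.inter_subset_inter_left _ (hGB i))
  · rw [Set.Finite.disjoint_toFinset, Set.disjoint_left]
    exact fun x hx hx' => Set.disjoint_left.1 (hdisj i j hij) (lamSet_subset hn _ hx.1)
      (lamSet_subset hn _ hx'.1)
  · have hx' := ((Set.Finite.mem_toFinset _).1 hx).1
    rw [shift_flatten_eq subset_rfl hx' (hk y hy), shift_flatten_eq (hBA i) hx' (hk y hy)]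

theorem tendsto_ncard_lamSet_div {d : ℕ} {L : AddSubgroup (V d)}
    (hL : ∃ N : ℕ, 0 < N ∧ ∀ x : V d, (N : ℤ) • x ∈ L) {D D' : Set (Fin d → ℝ)}
    (hb : Bornology.IsBounded D) (hc : Convex ℝ D) (hv : 0 < volume D)
    (hb' : Bornology.IsBounded D') (hc' : Convex ℝ D') (hv' : 0 < volume D') (m m' : ℕ) :
    Tendsto (fun n : ℕ => ((lamSet m' n D' ∩ (L : Set (V d))).ncard : ℝ) /
      (lamSet m n D ∩ (L : Set (V d))).ncard) atTop (𝓝 (volume.real D' / volume.real D)) := by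
  have := isZLattice_realLattice hL
  have hcov := ZLattice.covolume_pos (realLattice L) volume
  have hvr : 0 < volume.real D := ENNReal.toReal_pos hv.ne' hb.measure_lt_top.ne
  have h := (tendsto_ncard_lamSet hL hb' hc' hv' m').div (tendsto_ncard_lamSet hL hb hc hv m)
    (by positivity)
  rw [div_div_div_cancel_right₀ hcov.ne'] at h
  refine h.congr' ?_
  filter_upwards [eventually_gt_atTop 0] with n hn
  have hn' : (0 : ℝ) < n := by positivity
  exact div_div_div_cancel_right₀ (by positivity) _ _

theorem eventually_ncard_lamSet_pos {d : ℕ} {L : AddSubgroup (V d)}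
    (hL : ∃ N : ℕ, 0 < N ∧ ∀ x : V d, (N : ℤ) • x ∈ L) {D : Set (Fin d → ℝ)}
    (hb : Bornology.IsBounded D) (hc : Convex ℝ D) (hv : 0 < volume D) (m : ℕ) :
    ∀ᶠ n : ℕ in atTop, 0 < (lamSet m n D ∩ (L : Set (V d))).ncard := by
  have := isZLattice_realLattice hL
  have hcov := ZLattice.covolume_pos (realLattice L) volume
  have hvr : 0 < volume.real D := ENNReal.toReal_pos hv.ne' hb.measure_lt_top.ne
  filter_upwards [(tendsto_ncard_lamSet hL hb hc hv m).eventually (lt_mem_nhds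
    (div_pos hvr hcov))] with n hn
  rw [Nat.pos_iff_ne_zero]
  intro h0
  simp [h0] at hn

theorem measureReal_diff_iUnion_convex {d : ℕ} {D : Set (Fin d → ℝ)}
    (hb : Bornology.IsBounded D) {ι : Type*} [Fintype ι] {Ds : ι → Set (Fin d → ℝ)}
    (hc : ∀ i, Convex ℝ (Ds i)) (hDs : ∀ i, Ds i ⊆ D)
    (hdisj : ∀ i j, i ≠ j → Disjoint (Ds i) (Ds j)) :
    volume.real (D \ ⋃ i, Ds i) = volume.real D - ∑ i, volume.real (Ds i) := by
  have hm : ∀ i, NullMeasurableSet (Ds i) volume := fun i => (hc i).nullMeasurableSet volume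
  have hsub : ⋃ i, Ds i ⊆ D := Set.iUnion_subset hDs
  have hfin : volume (⋃ i, Ds i) ≠ ⊤ := (hb.subset hsub).measure_lt_top.ne
  have hU : volume (⋃ i, Ds i) = ∑ i, volume (Ds i) := by
    rw [measure_iUnion₀ (fun i j hij => (hdisj i j hij).aedisjoint) hm, tsum_fintype]
  rw [measureReal_def, measure_sdiff hsub (.iUnion hm) hfin,
    ENNReal.toReal_sub_of_le (measure_mono hsub) hb.measure_lt_top.ne, hU,
    ENNReal.toReal_sum fun i _ => (hb.subset (hDs i)).measure_lt_top.ne]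
  rfl

theorem limsup_abs_empAvg_sub_sum_le (E : Type*) [MeasurableSpace E] [Inhabited E] :
    Stmt15 E := by
  intro d _ L hL D hb hc hv m ι _ Ds ms hDs hdisj hms f hcyl hf
  obtain ⟨Δ, hΔ⟩ := hcyl.exists_eq_of_eqOn
  set k : ℕ := ∑ y ∈ Δ, dist1 0 y
  have hk : ∀ y ∈ Δ, dist1 0 y ≤ k := fun y hy =>
    Finset.single_le_sum (f := fun y : V d => dist1 0 y) (fun _ _ => Nat.zero_le _) hy
  have hvr : 0 < volume.real D := ENNReal.toReal_pos hv.ne' hb.measure_lt_top.ne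
  have hvi : ∀ i, volume.real (Ds i) ≠ 0 := fun i =>
    (ENNReal.toReal_pos (hDs i).2.2.1.ne' (hDs i).1.measure_lt_top.ne).ne'
  simp only [← measureReal_def]
  have hlim : Tendsto (fun n : ℕ =>
      (1 - ∑ i, ((lamSet (ms i + k) n (Ds i) ∩ (L : Set (V d))).ncard : ℝ) /
          (lamSet m n D ∩ (L : Set (V d))).ncard) +
        ∑ i, (|((lamSet (ms i) n (Ds i) ∩ (L : Set (V d))).ncard : ℝ) /
            (lamSet m n D ∩ (L : Set (V d))).ncard - volume.real (Ds i) / volume.real D| +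
          volume.real (Ds i) / volume.real D *
            (1 - ((lamSet (ms i + k) n (Ds i) ∩ (L : Set (V d))).ncard : ℝ) /
            (lamSet (ms i) n (Ds i) ∩ (L : Set (V d))).ncard))) atTop
      (𝓝 (volume.real (D \ ⋃ i, Ds i) / volume.real D)) := by
    have e : volume.real (D \ ⋃ i, Ds i) / volume.real D =
        (1 - ∑ i, volume.real (Ds i) / volume.real D) +
          ∑ i, (|volume.real (Ds i) / volume.real D - volume.real (Ds i) / volume.real D| +
            volume.real (Ds i) / volume.real D *
              (1 - volume.real (Ds i) / volume.real (Ds i))) := by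
      rw [measureReal_diff_iUnion_convex hb (fun i => (hDs i).2.1) (fun i => (hDs i).2.2.2) hdisj,
        sub_div, div_self hvr.ne', Finset.sum_div]
      simp [hvi]
    rw [e]
    refine (tendsto_const_nhds.sub (tendsto_finsetSum _ fun i _ => ?_)).add
      (tendsto_finsetSum _ fun i _ => Tendsto.add (Tendsto.abs (Tendsto.sub_const ?_ _))
        (Tendsto.const_mul _ (tendsto_const_nhds.sub ?_)))
    · exact tendsto_ncard_lamSet_div hL hb hc hv (hDs i).1 (hDs i).2.1 (hDs i).2.2.1 _ _
    · exact tendsto_ncard_lamSet_div hL hb hc hv (hDs i).1 (hDs i).2.1 (hDs i).2.2.1 _ _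
    · exact tendsto_ncard_lamSet_div hL (hDs i).1 (hDs i).2.1 (hDs i).2.2.1 (hDs i).1
        (hDs i).2.1 (hDs i).2.2.1 _ _
  rw [← hlim.limsup_eq]
  refine limsup_le_limsup ?_ ?_ hlim.isBoundedUnder_le
  · filter_upwards [eventually_gt_atTop 0, eventually_ncard_lamSet_pos hL hb hc hv m,
      eventually_all.2 fun i => eventually_ncard_lamSet_pos hL (hDs i).1 (hDs i).2.1
        (hDs i).2.2.1 (ms i)] with n hn hA hB
    exact ciSup_le fun φ => abs_empAvg_sub_sum_le L hb (fun i => (hDs i).2.2.2) hdisj hms hf hΔ hk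
      (fun i => by positivity) hn hA hB φ
  · exact isCoboundedUnder_le_of_le atTop (x := 0) fun n =>
      Real.iSup_nonneg fun φ => abs_nonneg _

/-- (comparison of empirical measures), for `E = ℤ` and `E = ℝ`. -/
theorem statement15 : Stmt15 ℤ ∧ Stmt15 ℝ :=
  ⟨limsup_abs_empAvg_sub_sum_le ℤ, limsup_abs_empAvg_sub_sum_le ℝ⟩

end
end

section
/- Suppose Λ ⊆ ℤ^d is finite, nonempty and connected, and its complement Δ := ℤ^d∖Λ is *-connected. Then ∂*Δ ∩ Λ is connected, and ∂*Δ is connected. -/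
open Set

noncomputable section

/-- `*`-adjacency: `‖x - y‖_∞ = 1`. -/
def adjS {d : ℕ} (x y : V d) : Prop := x ≠ y ∧ ∀ i, (x i - y i).natAbs ≤ 1

/-- The `*`-connected component of `x` inside `s`. -/
def compInS {d : ℕ} (s : Set (V d)) (x : V d) : Set (V d) :=
  {y | Relation.ReflTransGen (fun a b => a ∈ s ∧ b ∈ s ∧ adjS a b) x y}

/-- `s` is `*`-connected. -/
def ConnSetS {d : ℕ} (s : Set (V d)) : Prop := ∀ x ∈ s, ∀ y ∈ s, y ∈ compInS s x

/-- The boundary `∂*Δ`: vertices outside `Δ` that are `*`-adjacent to `Δ`, together with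
vertices of `Δ` adjacent to the complement of `Δ`. -/
def starBd {d : ℕ} (Δ : Set (V d)) : Set (V d) :=
  {x | (x ∉ Δ ∧ ∃ y ∈ Δ, adjS x y) ∨ (x ∈ Δ ∧ ∃ y : V d, y ∉ Δ ∧ adj1 x y)}

theorem exists_int_antidifference {A : Type*} [AddCommGroup A] (u : ℤ → A) :
    ∃ U : ℤ → A, ∀ n, U (n + 1) = U n + u n := by
  refine ⟨fun n => ∑ k ∈ Finset.Ico 0 n, u k - ∑ k ∈ Finset.Ico n 0, u k, fun n => ?_⟩
  rcases le_or_gt 0 n with h | h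
  · have h₁ : Finset.Ico 0 (n + 1) = insert n (Finset.Ico 0 n) := by
      ext k; simp only [Finset.mem_Ico, Finset.mem_insert]; omega
    simp [h₁, Finset.Ico_eq_empty_of_le h, Finset.Ico_eq_empty_of_le (show 0 ≤ n + 1 by omega),
      add_comm]
  · have h₁ : Finset.Ico n 0 = insert n (Finset.Ico (n + 1) 0) := by
      ext k; simp only [Finset.mem_Ico, Finset.mem_insert]; omega
    simp [h₁, Finset.Ico_eq_empty_of_le h.le, Finset.Ico_eq_empty_of_le (show n + 1 ≤ 0 by omega)]

/-- A lattice one-form which is closed on every unit square is exact. -/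
theorem exists_lattice_potential {A : Type*} [AddCommGroup A] {d : ℕ} (c : Fin d → V d → A)
    (hc : ∀ i j x, c i x + c j (x + Pi.single i 1) = c j x + c i (x + Pi.single j 1)) :
    ∃ f : V d → A, ∀ i x, f (x + Pi.single i 1) = f x + c i x := by
  classical
  choose U hU using fun u : ℤ → A => exists_int_antidifference u
  suffices H : ∀ T : Finset (Fin d), ∃ f : V d → A, ∀ i ∈ T, ∀ x,
      f (x + Pi.single i 1) = f x + c i x by
    obtain ⟨f, hf⟩ := H Finset.univ
    exact ⟨f, fun i => hf i (Finset.mem_univ i)⟩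
  intro T
  induction T using Finset.induction_on with
  | empty => exact ⟨0, by simp⟩
  | insert j T hj ih =>
    obtain ⟨f, hf⟩ := ih
    let b : V d → A := fun x => c j x - (f (x + Pi.single j 1) - f x)
    have hb : ∀ i ∈ T, ∀ x, b (x + Pi.single i 1) = b x := by
      intro i hi x
      have h₁ := hc i j x
      have h₂ := hf i hi x
      have h₃ := hf i hi (x + Pi.single j 1)
      rw [add_right_comm] at h₃
      simp only [b, h₂, h₃, eq_sub_of_add_eq' h₁]
      abel
    refine ⟨fun x => f x + U (fun n => b (Function.update x j n)) (x j), fun i hi x => ?_⟩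
    rcases Finset.mem_insert.1 hi with rfl | hi
    · have h₁ : (fun n => b (Function.update (x + Pi.single i 1) i n)) =
          fun n => b (Function.update x i n) := by
        funext n
        congr 1
        ext k
        by_cases h : k = i
        · subst h; simp
        · simp [h]
      simp only [h₁, Pi.add_apply, Pi.single_eq_same, hU, Function.update_eq_self, b]
      abel
    · have hij : j ≠ i := fun h => hj (h ▸ hi)
      have h₁ : (fun n => b (Function.update (x + Pi.single i 1) j n)) =
          fun n => b (Function.update x j n) := by
        funext n
        rw [← hb i hi (Function.update x j n)]
        congr 1
        ext k
        by_cases h : k = j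
        · subst h; simp [hij]
        · simp [h]
      simp only [h₁, Pi.add_apply, Pi.single_eq_of_ne hij, add_zero, hf i hi]
      abel

theorem adj1_comm {d : ℕ} {x y : V d} : adj1 x y ↔ adj1 y x := by
  have h : ∀ i, (x i - y i).natAbs = (y i - x i).natAbs := fun i => by omega
  simp only [adj1, dist1, h]

theorem adjS_comm {d : ℕ} {x y : V d} : adjS x y ↔ adjS y x := by
  have h : ∀ i, (x i - y i).natAbs = (y i - x i).natAbs := fun i => by omega
  simp only [adjS, h, ne_comm]

theorem adj1_add_single {d : ℕ} (x : V d) (i : Fin d) : adj1 x (x + Pi.single i 1) := by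
  unfold adj1 dist1
  rw [Finset.sum_eq_single i]
  · simp
  · intro j _ hj; simp [hj]
  · simp

theorem adj1.adjS {d : ℕ} {x y : V d} (h : adj1 x y) : adjS x y := by
  constructor
  · rintro rfl
    simp [adj1, dist1] at h
  · intro i
    rw [← show dist1 x y = 1 from h]
    exact Finset.single_le_sum (f := fun i => (x i - y i).natAbs) (fun _ _ => Nat.zero_le _)
      (Finset.mem_univ i)

theorem adj1.exists_eq_add_single {d : ℕ} {x y : V d} (h : adj1 x y) :
    ∃ i, y = x + Pi.single i 1 ∨ x = y + Pi.single i 1 := by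
  obtain ⟨i, hi⟩ : ∃ i, x i ≠ y i := Function.ne_iff.1 h.adjS.1
  have hs : (x i - y i).natAbs + ∑ j ∈ Finset.univ.erase i, (x j - y j).natAbs = 1 := by
    rw [Finset.add_sum_erase _ (fun j => (x j - y j).natAbs) (Finset.mem_univ i)]
    exact h
  have hz : ∑ j ∈ Finset.univ.erase i, (x j - y j).natAbs = 0 := by omega
  have hj : ∀ j, j ≠ i → x j = y j := fun j hj => by
    have := Finset.sum_eq_zero_iff.1 hz j (by simp [hj])
    omega
  refine ⟨i, ?_⟩
  rcases (show y i = x i + 1 ∨ x i = y i + 1 by omega) with h | h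
  · left; ext j
    by_cases hji : j = i
    · subst hji; simpa using h
    · simp [hji, hj j hji]
  · right; ext j
    by_cases hji : j = i
    · subst hji; simpa using h
    · simp [hji, hj j hji]

/-- A function that is unchanged along the nearest-neighbour edges of the box spanned by two
`*`-adjacent points takes the same value at both. -/
theorem eq_of_box_edges {α : Type*} {d : ℕ} {a b : V d} (hab : adjS a b) (F : V d → α)
    (hF : ∀ p q : V d, (∀ i, p i = a i ∨ p i = b i) → (∀ i, q i = a i ∨ q i = b i) →
      adj1 p q → F p = F q) : F a = F b := by
  classical
  have H : ∀ T : Finset (Fin d), F a = F (T.piecewise b a) := by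
    intro T
    induction T using Finset.induction_on with
    | empty => simp
    | insert j T hj ih =>
      rw [ih]
      have hbox : ∀ (T : Finset (Fin d)) i,
          T.piecewise b a i = a i ∨ T.piecewise b a i = b i := fun T i => by
        by_cases h : i ∈ T <;> simp [h]
      by_cases hne : b j = a j
      · congr 1
        rw [Finset.piecewise_insert]
        symm
        rw [Function.update_eq_iff]
        simp [hj, hne]
      · refine hF _ _ (hbox T) (hbox _) ?_
        unfold adj1 dist1
        rw [Finset.sum_eq_single j]
        · have := hab.2 j
          simp only [Finset.mem_insert_self, Finset.piecewise_eq_of_mem,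
            Finset.piecewise_eq_of_notMem _ _ _ hj]
          omega
        · intro k _ hk
          by_cases h : k ∈ T <;> simp [h, hk]
        · simp
  simpa using H Finset.univ

theorem mem_starBd_compl_inter {d : ℕ} {Λ : Set (V d)} {x : V d} :
    x ∈ starBd Λᶜ ∩ Λ ↔ x ∈ Λ ∧ ∃ y ∉ Λ, adjS x y := by
  constructor
  · rintro ⟨⟨-, h⟩ | ⟨h, -⟩, hx⟩
    · exact ⟨hx, h⟩
    · exact absurd hx h
  · rintro ⟨hx, h⟩
    exact ⟨Or.inl ⟨not_not.2 hx, h⟩, hx⟩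

theorem connSet_starBd_compl_inter {d : ℕ} {Λ : Set (V d)} (hconn : ConnSet Λ)
    (hstar : ConnSetS Λᶜ) : ConnSet (starBd Λᶜ ∩ Λ) := by
  classical
  intro x hx x' hx'
  set S := starBd Λᶜ ∩ Λ with hS
  let P : V d → ℤ := fun a => if a ∈ compIn S x then 1 else 0
  have hP : ∀ a ∈ S, ∀ b ∈ S, adj1 a b → P a = P b := by
    intro a ha b hb hab
    have : a ∈ compIn S x ↔ b ∈ compIn S x :=
      ⟨fun h => h.tail ⟨ha, hb, hab⟩, fun h => h.tail ⟨hb, ha, adj1_comm.1 hab⟩⟩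
    simp only [P, this]
  let c : V d → V d → ℤ := fun a b => if a ∈ Λ ∧ b ∈ Λ then P b - P a else 0
  have hcΛ : ∀ a ∈ Λ, ∀ b ∈ Λ, c a b = P b - P a := fun a ha b hb => if_pos ⟨ha, hb⟩
  have hc0 : ∀ y ∉ Λ, ∀ a b, adj1 a b → (∀ i, (a i - y i).natAbs ≤ 1) →
      (∀ i, (b i - y i).natAbs ≤ 1) → c a b = 0 := by
    intro y hy a b hab ha hb
    by_cases h : a ∈ Λ ∧ b ∈ Λ
    · have haS : a ∈ S := mem_starBd_compl_inter.2
        ⟨h.1, y, hy, fun e => hy (e ▸ h.1), ha⟩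
      have hbS : b ∈ S := mem_starBd_compl_inter.2
        ⟨h.2, y, hy, fun e => hy (e ▸ h.2), hb⟩
      rw [hcΛ a h.1 b h.2, hP a haS b hbS hab, sub_self]
    · exact if_neg h
  obtain ⟨F, hF⟩ := exists_lattice_potential (fun i a => c a (a + Pi.single i 1)) (by
    intro i j a
    rcases eq_or_ne i j with rfl | hij
    · rfl
    rw [add_right_comm a (Pi.single j 1)]
    by_cases hsq : a ∈ Λ ∧ a + Pi.single i 1 ∈ Λ ∧ a + Pi.single j 1 ∈ Λ ∧
        a + Pi.single i 1 + Pi.single j 1 ∈ Λ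
    · obtain ⟨h₀, h₁, h₂, h₃⟩ := hsq
      rw [hcΛ _ h₀ _ h₁, hcΛ _ h₁ _ h₃, hcΛ _ h₀ _ h₂, hcΛ _ h₂ _ h₃]
      ring
    · obtain ⟨y, hy, hya⟩ : ∃ y ∉ Λ, ∀ k, y k = a k ∨ (y k = a k + 1 ∧ (k = i ∨ k = j)) := by
        by_contra! hcon
        refine hsq ⟨?_, ?_, ?_, ?_⟩ <;> by_contra hy <;> obtain ⟨k, hk₁, hk₂⟩ := hcon _ hy <;>
          by_cases hki : k = i <;> by_cases hkj : k = j <;> simp_all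
      have hne : ∀ k, k = i → k ≠ j := fun k h => h ▸ hij
      have h01 : ∀ k l : Fin d, (Pi.single k 1 : V d) l = if l = k then 1 else 0 :=
        fun k l => Pi.single_apply _ _ _
      have e₁ := adj1_add_single (a + Pi.single i 1) j
      have e₂ := adj1_add_single (a + Pi.single j 1) i
      rw [add_right_comm] at e₂
      rw [hc0 y hy _ _ (adj1_add_single a i), hc0 y hy _ _ e₁,
        hc0 y hy _ _ (adj1_add_single a j), hc0 y hy _ _ e₂]
      all_goals
        intro k
        have := hya k
        have := hne k
        try simp only [Pi.add_apply, h01]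
        (try split_ifs) <;> omega)
  have hFΛ : ∀ a ∈ Λ, ∀ b ∈ Λ, adj1 a b → F b - P b = F a - P a := by
    intro a ha b hb hab
    obtain ⟨i, rfl | rfl⟩ := hab.exists_eq_add_single
    · rw [hF, hcΛ a ha _ hb]; ring
    · rw [hF, hcΛ b hb _ ha]; ring
  have hFΔ : ∀ y ∉ Λ, ∀ a, adjS a y → F a = F y := by
    intro y hy a hay
    refine eq_of_box_edges hay F fun p q hp hq hpq => ?_
    have hnear : ∀ p : V d, (∀ i, p i = a i ∨ p i = y i) → ∀ i, (p i - y i).natAbs ≤ 1 := by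
      intro p hp i
      have := hay.2 i
      rcases hp i with h | h <;> rw [h]
      · exact this
      · simp
    obtain ⟨i, rfl | rfl⟩ := hpq.exists_eq_add_single
    · rw [hF, hc0 y hy _ _ hpq (hnear _ hp) (hnear _ hq), add_zero]
    · rw [hF, hc0 y hy _ _ (adj1_comm.1 hpq) (hnear _ hq) (hnear _ hp), add_zero]
  have hΛ : F x' - P x' = F x - P x := by
    have H : ∀ z, z ∈ compIn Λ x → F z - P z = F x - P x := by
      intro z hz
      induction hz with
      | refl => rfl
      | tail _ h ih => rw [← ih]; exact hFΛ _ h.1 _ h.2.1 h.2.2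
    exact H x' (hconn x hx.2 x' hx'.2)
  obtain ⟨-, y, hy, hxy⟩ := mem_starBd_compl_inter.1 hx
  obtain ⟨-, y', hy', hxy'⟩ := mem_starBd_compl_inter.1 hx'
  have hΔ : F y' = F y := by
    have H : ∀ z, z ∈ compInS Λᶜ y → F z = F y := by
      intro z hz
      induction hz with
      | refl => rfl
      | tail _ h ih => rw [← ih]; exact (hFΔ _ h.2.1 _ h.2.2).symm
    exact H y' (hstar y hy y' hy')
  have hPP : P x' = P x := by
    have := hFΔ y hy x hxy
    have := hFΔ y' hy' x' hxy'
    omega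
  have hPx : P x = 1 := if_pos Relation.ReflTransGen.refl
  by_contra hcon
  have hPx' : P x' = 0 := if_neg hcon
  omega

/-- connectivity of `∂*Δ`. -/
theorem statement18 (d : ℕ) (hd : 2 ≤ d) (Λ : Set (V d)) (hfin : Λ.Finite)
    (hne : Λ.Nonempty) (hconn : ConnSet Λ) (hstar : ConnSetS Λᶜ) :
    ConnSet (starBd Λᶜ ∩ Λ) ∧ ConnSet (starBd Λᶜ) := by
  have hS := connSet_starBd_compl_inter hconn hstar
  refine ⟨hS, fun x hx y hy => ?_⟩
  have key : ∀ x ∈ starBd Λᶜ, ∃ z ∈ starBd Λᶜ ∩ Λ,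
      z ∈ compIn (starBd Λᶜ) x ∧ x ∈ compIn (starBd Λᶜ) z := by
    intro x hx
    by_cases hxΛ : x ∈ Λ
    · exact ⟨x, ⟨hx, hxΛ⟩, Relation.ReflTransGen.refl, Relation.ReflTransGen.refl⟩
    · obtain ⟨h, -⟩ | ⟨-, z, hz, hxz⟩ := id hx
      · exact absurd (not_not.1 h) hxΛ
      · have hzS : z ∈ starBd Λᶜ ∩ Λ := mem_starBd_compl_inter.2
          ⟨not_not.1 hz, x, hxΛ, adjS_comm.1 hxz.adjS⟩
        exact ⟨z, hzS, Relation.ReflTransGen.single ⟨hx, hzS.1, hxz⟩,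
          Relation.ReflTransGen.single ⟨hzS.1, hx, adj1_comm.1 hxz⟩⟩
  obtain ⟨z, hz, hxz, -⟩ := key x hx
  obtain ⟨w, hw, -, hwy⟩ := key y hy
  have hzw : w ∈ compIn (starBd Λᶜ) z :=
    Relation.ReflTransGen.mono (fun _ _ h => ⟨h.1.1, h.2.1.1, h.2.2⟩) _ _ (hS z hz w hw)
  exact hxz.trans (hzw.trans hwy)

end
end
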